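/- arXiv:1104.0627 — 2 statements merged into one kernel-verified Lean document; each statement's English description precedes it below -/
import Mathlib

section
/- Let A be an Artin algebra and X a finitely generated right A-module which is Ext-projective in gen(X), and set a = ann_A(X). Then X has projective dimension at most 1 as a right A/a-module; that is, there exists a short exact sequence 0 → Q₁ → Q₀ → X → 0 of right A/a-modules in which Q₀ and Q₁ are finitely generated projective A/a-modules. -/
open CategoryTheory

section Prelim

variable (A : Type) [Ring A]

/-- `M` lies in `gen(X)`: some finite direct sum of copies of `X` surjects onto `M`. -/
def IsGenBy (X M : Type) [AddCommGroup X] [Module A X] [AddCommGroup M] [Module A M] : Prop :=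
  ∃ (n : ℕ) (f : (Fin n → X) →ₗ[A] M), Function.Surjective f

/-- `M` lies in `cog(Y)`: `M` embeds into some finite direct sum of copies of `Y`. -/
def IsCogBy (Y M : Type) [AddCommGroup Y] [Module A Y] [AddCommGroup M] [Module A M] : Prop :=
  ∃ (n : ℕ) (f : M →ₗ[A] (Fin n → Y)), Function.Injective f

/-- `M` is a direct summand of a finite direct sum of copies of `X`. -/
def IsDirectSummandOf (X M : Type) [AddCommGroup X] [Module A X] [AddCommGroup M]
    [Module A M] : Prop :=
  ∃ (n : ℕ) (i : M →ₗ[A] (Fin n → X)) (r : (Fin n → X) →ₗ[A] M), r ∘ₗ i = LinearMap.id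

/-- `Ext¹_A(M, N)`. -/
noncomputable abbrev ext1 (M N : Type) [AddCommGroup M] [Module A M]
    [AddCommGroup N] [Module A N] : ModuleCat ℤ :=
  ((Ext ℤ (ModuleCat A) 1).obj (Opposite.op (ModuleCat.of A M))).obj (ModuleCat.of A N)

/-- The ring congruence on `A` identifying `a` and `b` iff `a - b` annihilates `X`. -/
def annRingCon (X : Type) [AddCommGroup X] [Module A X] : RingCon A where
  r a b := ∀ x : X, a • x = b • x
  iseqv := ⟨fun _ _ => rfl, fun h x => (h x).symm, fun h1 h2 x => (h1 x).trans (h2 x)⟩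
  mul' := @fun a b c d h1 h2 x => by
    show (a * c) • x = (b * d) • x
    rw [mul_smul, mul_smul, h2, h1]
  add' := @fun a b c d h1 h2 x => by
    show (a + c) • x = (b + d) • x
    rw [add_smul, add_smul, h1 x, h2 x]

/-- The factor algebra `A/ann_A(X)`. -/
abbrev AnnQuot (X : Type) [AddCommGroup X] [Module A X] : Type := (annRingCon A X).Quotient

instance (X : Type) [AddCommGroup X] [Module A X] : SMul (AnnQuot A X) X :=
  ⟨fun c x => Quotient.liftOn' c (fun a => a • x) (fun _ _ h => h x)⟩

/-- `X` is a module over `A/ann_A(X)`. -/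
instance (X : Type) [AddCommGroup X] [Module A X] : Module (AnnQuot A X) X where
  one_smul x := one_smul A x
  mul_smul c d x := Quotient.inductionOn₂' c d fun a b => mul_smul a b x
  smul_zero c := Quotient.inductionOn' c fun a => smul_zero a
  smul_add c x y := Quotient.inductionOn' c fun a => smul_add a x y
  add_smul c d x := Quotient.inductionOn₂' c d fun a b => add_smul a b x
  zero_smul x := zero_smul A x

end Prelim

namespace CategoryTheory.ProjectiveResolution

/-- If `Ext¹(X, Y)` vanishes, every `1`-cocycle on a projective resolution of `X` with values
in `Y` is a coboundary. -/
theorem exists_d_comp_eq_of_subsingleton_ext {C : Type*} [Category* C] [Abelian C]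
    [EnoughProjectives C] {X Y : C} (P : ProjectiveResolution X)
    (h : Subsingleton (((Ext ℤ C 1).obj (Opposite.op X)).obj Y))
    (c : P.complex.X 1 ⟶ Y) (hc : P.complex.d 2 1 ≫ c = 0) :
    ∃ g : P.complex.X 0 ⟶ Y, P.complex.d 1 0 ≫ g = c := by
  have hzero : Limits.IsZero ((P.complex.linearYonedaObj ℤ Y).homology 1) :=
    (ModuleCat.isZero_iff_subsingleton.mpr h).of_iso (P.isoExt 1 Y).symm
  rw [← HomologicalComplex.exactAt_iff_isZero_homology,
    HomologicalComplex.exactAt_iff' _ 0 1 2 (by simp) (by simp),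
    ShortComplex.moduleCat_exact_iff] at hzero
  exact hzero c hc

end CategoryTheory.ProjectiveResolution

/-- If `Ext¹(X, N)` vanishes, every linear map from the kernel of a surjection `Q → X` to `N`
extends to `Q`. -/
theorem exists_extension_of_subsingleton_ext1 {A : Type} [Ring A] {X N Q : Type}
    [AddCommGroup X] [Module A X] [AddCommGroup N] [Module A N] [AddCommGroup Q] [Module A Q]
    (h : Subsingleton (ext1 A X N)) (g : Q →ₗ[A] X) (hg : Function.Surjective g)
    (φ : LinearMap.ker g →ₗ[A] N) :
    ∃ ψ : Q →ₗ[A] N, ψ ∘ₗ (LinearMap.ker g).subtype = φ := by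
  let P := projectiveResolution (ModuleCat.of A X)
  let ε : P.complex.X 0 ⟶ ModuleCat.of A X := P.π.f 0
  let d : P.complex.X 1 ⟶ P.complex.X 0 := P.complex.d 1 0
  have hdε : d ≫ ε = 0 := P.complex_d_comp_π_f_zero
  have hexact : ∀ p, ε.hom p = 0 → ∃ q, d.hom q = p :=
    (ShortComplex.moduleCat_exact_iff _).mp P.exact₀
  have hε : Function.Surjective ε.hom := (ModuleCat.epi_iff_surjective _).mp
    (inferInstanceAs (Epi (P.π.f 0)))
  have : Module.Projective A (P.complex.X 0) :=
    (IsProjective.iff_projective _).mpr (P.projective 0)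
  obtain ⟨u, hu⟩ := Module.projective_lifting_property g ε.hom hg
  have hgu (p) : g (u p) = ε.hom p := LinearMap.congr_fun hu p
  have hεd (q) : ε.hom (d.hom q) = 0 := LinearMap.congr_fun (congrArg ModuleCat.Hom.hom hdε) q
  let v : P.complex.X 1 →ₗ[A] LinearMap.ker g :=
    (u ∘ₗ d.hom).codRestrict _ fun q => by simp [hgu, hεd]
  obtain ⟨w, hw⟩ := P.exists_d_comp_eq_of_subsingleton_ext h (ModuleCat.ofHom (φ ∘ₗ v)) (by
    ext q
    have hdd : d.hom ((P.complex.d 2 1).hom q) = 0 :=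
      LinearMap.congr_fun (congrArg ModuleCat.Hom.hom (P.complex.d_comp_d 2 1 0)) q
    have hv : v ((P.complex.d 2 1).hom q) = 0 := Subtype.ext (by
      change u (d.hom _) = 0
      rw [hdd, map_zero])
    exact (congrArg φ hv).trans φ.map_zero)
  have hw' (q) : w.hom (d.hom q) = φ (v q) :=
    LinearMap.congr_fun (congrArg ModuleCat.Hom.hom hw) q
  let s : LinearMap.ker g × P.complex.X 0 →ₗ[A] Q := (LinearMap.ker g).subtype.coprod u
  let t : LinearMap.ker g × P.complex.X 0 →ₗ[A] N := φ.coprod w.hom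
  have hs : Function.Surjective s := fun y => by
    obtain ⟨p, hp⟩ := hε (g y)
    exact ⟨(⟨y - u p, by simp [hgu, hp]⟩, p), by simp [s]⟩
  have hst : LinearMap.ker s ≤ LinearMap.ker t := by
    rintro ⟨k, p⟩ hkp
    have hkp : (k : Q) + u p = 0 := by simpa [s] using hkp
    obtain ⟨q, rfl⟩ := hexact p (by
      rw [← hgu, eq_neg_of_add_eq_zero_right hkp, map_neg, k.2, neg_zero])
    have hk : k = -v q := Subtype.ext (eq_neg_of_add_eq_zero_left hkp)
    simp [t, hk, hw']
  refine ⟨(LinearMap.ker s).liftQ t hst ∘ₗ (s.quotKerEquivOfSurjective hs).symm, ?_⟩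
  ext k
  have hk : (s.quotKerEquivOfSurjective hs).symm (k : Q) = Submodule.Quotient.mk (k, 0) := by
    rw [LinearEquiv.symm_apply_eq]
    simp [s]
  simp [hk, t]

/-- Let `g : Q → X` be a linear map with `Q` projective and finitely generated kernel. If `B`
embeds into a finite power of `X` and every map from `ker g` to an object of `gen(X)` extends
to `Q`, then `ker g` is projective. -/
theorem projective_ker_of_extension {B : Type} [Ring B] {X Q : Type}
    [AddCommGroup X] [Module B X] [AddCommGroup Q] [Module B Q] [Module.Projective B Q]
    (g : Q →ₗ[B] X) [Module.Finite B (LinearMap.ker g)]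
    {m : ℕ} (j : B →ₗ[B] (Fin m → X)) (hj : Function.Injective j)
    (hext : ∀ (N : Type) [AddCommGroup N] [Module B N], IsGenBy B X N →
      ∀ φ : LinearMap.ker g →ₗ[B] N, ∃ ψ : Q →ₗ[B] N, ψ ∘ₗ (LinearMap.ker g).subtype = φ) :
    Module.Projective B (LinearMap.ker g) := by
  obtain ⟨n, p, hp⟩ := Module.Finite.exists_fin' B (LinearMap.ker g)
  let h : (Fin n → B) →ₗ[B] (Fin n → Fin m → X) := j.compLeft (Fin n)
  have hh : Function.Injective h := fun a b hab =>
    funext fun i => hj (congrFun hab i)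
  let M : Submodule B (Fin n → Fin m → X) := (LinearMap.ker p).map h
  have hgen : IsGenBy B X ((Fin n → Fin m → X) ⧸ M) :=
    ⟨n * m, M.mkQ ∘ₗ ((LinearEquiv.funCongrLeft B X finProdFinEquiv).trans
      (LinearEquiv.curry B X (Fin n) (Fin m))).toLinearMap,
      M.mkQ_surjective.comp (LinearEquiv.surjective _)⟩
  have hker : LinearMap.ker p ≤ LinearMap.ker (M.mkQ ∘ₗ h) := fun x hx => by
    simpa using Submodule.mem_map_of_mem hx
  let e := p.quotKerEquivOfSurjective hp
  have he (x) : e.symm (p x) = Submodule.Quotient.mk x := by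
    rw [LinearEquiv.symm_apply_eq]; rfl
  obtain ⟨ψ, hψ⟩ := hext _ hgen ((LinearMap.ker p).liftQ _ hker ∘ₗ e.symm)
  obtain ⟨χ, hχ⟩ := Module.projective_lifting_property M.mkQ ψ M.mkQ_surjective
  have hmem (x : Fin n → B) : h x - χ (p x) ∈ M := by
    rw [← Submodule.Quotient.mk_eq_zero, Submodule.Quotient.mk_sub, sub_eq_zero]
    have h₁ : ψ (p x) = M.mkQ (h x) := by
      simpa [he] using LinearMap.congr_fun hψ (p x)
    exact h₁.symm.trans (LinearMap.congr_fun hχ _).symm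
  have hex (x : Fin n → B) : ∃ y ∈ LinearMap.ker p, h y = h x - χ (p x) := hmem x
  let f : LinearMap.ker g →ₗ[B] (Fin n → Fin m → X) := χ ∘ₗ (LinearMap.ker g).subtype
  have hrange : LinearMap.range f ≤ LinearMap.range h := by
    rintro _ ⟨k, rfl⟩
    obtain ⟨x, rfl⟩ := hp k
    obtain ⟨y, -, hy⟩ := hex x
    exact ⟨x - y, by rw [map_sub, hy, sub_sub_cancel]; rfl⟩
  let σ : LinearMap.ker g →ₗ[B] (Fin n → B) :=
    (LinearEquiv.ofInjective h hh).symm.toLinearMap ∘ₗ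
      f.codRestrict _ fun k => hrange ⟨k, rfl⟩
  have hσ (k) : h (σ k) = χ k :=
    congrArg Subtype.val ((LinearEquiv.ofInjective h hh).apply_symm_apply _)
  refine Module.Projective.of_split σ p (LinearMap.ext fun k => ?_)
  obtain ⟨x, rfl⟩ := hp k
  obtain ⟨y, hy, hyx⟩ := hex x
  have hxy : σ (p x) = x - y := hh (by rw [hσ, map_sub, hyx, sub_sub_cancel])
  simp [hxy, LinearMap.mem_ker.mp hy]

/-- Ext-projectivity of `X` in `gen(X)` over `A` gives the extension property for
modules over `A/ann_A(X)`. -/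
theorem exists_extension_annQuot {A : Type} [Ring A] {X : Type} [AddCommGroup X] [Module A X]
    (hX : ∀ (N : Type) [AddCommGroup N] [Module A N], IsGenBy A X N →
      Subsingleton (ext1 A X N))
    {Q : Type} [AddCommGroup Q] [Module (AnnQuot A X) Q]
    (g : Q →ₗ[AnnQuot A X] X) (hg : Function.Surjective g)
    (N : Type) [AddCommGroup N] [Module (AnnQuot A X) N] (hN : IsGenBy (AnnQuot A X) X N)
    (φ : LinearMap.ker g →ₗ[AnnQuot A X] N) :
    ∃ ψ : Q →ₗ[AnnQuot A X] N, ψ ∘ₗ (LinearMap.ker g).subtype = φ := by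
  let π : A →+* AnnQuot A X := (annRingCon A X).mk'
  let : Module A Q := Module.compHom Q π
  let : Module A N := Module.compHom N π
  obtain ⟨n, f, hf⟩ := hN
  let f' : (Fin n → X) →ₗ[A] N :=
    { f.toAddMonoidHom with map_smul' := fun a x => f.map_smul (π a) x }
  let g' : Q →ₗ[A] X :=
    { g.toAddMonoidHom with map_smul' := fun a x => g.map_smul (π a) x }
  let φ' : LinearMap.ker g' →ₗ[A] N :=
    { toFun := fun k => φ ⟨k, k.2⟩
      map_add' := fun k l => φ.map_add ⟨k, k.2⟩ ⟨l, l.2⟩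
      map_smul' := fun a k => φ.map_smul (π a) ⟨k, k.2⟩ }
  obtain ⟨ψ, hψ⟩ := exists_extension_of_subsingleton_ext1 (hX N ⟨n, f', hf⟩) g' hg φ'
  refine ⟨{ ψ.toAddMonoidHom with map_smul' := fun b x => ?_ }, LinearMap.ext fun k => ?_⟩
  · obtain ⟨a, rfl⟩ := (annRingCon A X).mk'_surjective b
    exact ψ.map_smul a x
  · exact LinearMap.congr_fun hψ ⟨k, k.2⟩

/-- Over a finite `R`-algebra `A`, the algebra `A/ann_A(X)` embeds into a finite power of a finitely
generated module `X`. -/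
theorem exists_injective_annQuot (R : Type) [CommRing R] (A : Type) [Ring A] [Algebra R A]
    [Module.Finite R A] (X : Type) [AddCommGroup X] [Module A X] [Module.Finite A X] :
    ∃ (m : ℕ) (j : AnnQuot A X →ₗ[AnnQuot A X] (Fin m → X)), Function.Injective j := by
  let : Module R X := Module.compHom X (algebraMap R A)
  have : IsScalarTower R A X := ⟨fun r a x => by
    change (r • a) • x = algebraMap R A r • a • x
    rw [Algebra.smul_def, mul_smul]⟩
  have : Module.Finite R X := Module.Finite.trans A X
  obtain ⟨m, x, hx⟩ := Module.Finite.exists_fin (R := R) (M := X)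
  refine ⟨m, LinearMap.toSpanSingleton _ _ x, ?_⟩
  intro b c hbc
  obtain ⟨a, rfl⟩ := (annRingCon A X).mk'_surjective b
  obtain ⟨a', rfl⟩ := (annRingCon A X).mk'_surjective c
  refine (RingCon.eq _).mpr fun y => ?_
  have hy : y ∈ Submodule.span R (Set.range x) := hx ▸ Submodule.mem_top
  induction hy using Submodule.span_induction with
  | mem y hy =>
    obtain ⟨i, rfl⟩ := hy
    exact congrFun hbc i
  | zero => simp
  | add y z _ _ hy hz => rw [smul_add, smul_add, hy, hz]
  | smul r y _ hy =>
    change a • algebraMap R A r • y = a' • algebraMap R A r • y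
    rw [← mul_smul, ← mul_smul, ← Algebra.commutes, ← Algebra.commutes, mul_smul, mul_smul, hy]

/-- If `X` is a finitely generated module over an Artin algebra `A` which is
Ext-projective in `gen(X)`, then `X` has projective dimension at most `1` over `A/ann_A(X)`. -/
theorem stmt0
    (R : Type) [CommRing R] [IsArtinianRing R] [IsLocalRing R]
    (A : Type) [Ring A] [Algebra R A] [Module.Finite R A]
    (X : Type) [AddCommGroup X] [Module A X] [Module.Finite A X]
    (hX : ∀ (N : Type) [AddCommGroup N] [Module A N], IsGenBy A X N →
      Subsingleton (ext1 A X N)) :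
    ∃ (Q₁ Q₀ : ModuleCat (AnnQuot A X)) (f : Q₁ →ₗ[AnnQuot A X] Q₀)
      (g : Q₀ →ₗ[AnnQuot A X] X),
      Module.Projective (AnnQuot A X) Q₁ ∧ Module.Projective (AnnQuot A X) Q₀ ∧
      Module.Finite (AnnQuot A X) Q₁ ∧ Module.Finite (AnnQuot A X) Q₀ ∧
      Function.Injective f ∧ Function.Exact f g ∧ Function.Surjective g := by
  let B := AnnQuot A X
  have hπ := (annRingCon A X).mk'_surjective
  have : IsArtinianRing A := IsArtinianRing.of_finite R A
  have : IsNoetherianRing B := isNoetherianRing_of_surjective A _ _ hπ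
  have : Module.Finite B X := by
    obtain ⟨s, hs⟩ := Module.Finite.fg_top (R := A) (M := X)
    refine ⟨s, eq_top_iff.mpr fun x _ => ?_⟩
    have hx : x ∈ Submodule.span A (s : Set X) := hs ▸ Submodule.mem_top
    induction hx using Submodule.span_induction with
    | mem x hx => exact Submodule.subset_span hx
    | zero => exact zero_mem _
    | add x y _ _ hx hy => exact add_mem (hx trivial) (hy trivial)
    | smul a x _ hx => exact Submodule.smul_mem _ ((annRingCon A X).mk' a) (hx trivial)
  obtain ⟨m, j, hj⟩ := exists_injective_annQuot R A X
  obtain ⟨n, g, hg⟩ := Module.Finite.exists_fin' B X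
  have : Module.Projective B (LinearMap.ker g) :=
    projective_ker_of_extension g j hj fun N _ _ hN φ =>
      exists_extension_annQuot hX g hg N hN φ
  refine ⟨ModuleCat.of B (ULift (LinearMap.ker g)), ModuleCat.of B (ULift (Fin n → B)),
    ULift.moduleEquiv.symm.toLinearMap ∘ₗ (LinearMap.ker g).subtype ∘ₗ
      ULift.moduleEquiv.toLinearMap,
    g ∘ₗ ULift.moduleEquiv.toLinearMap,
    Module.Projective.of_equiv ULift.moduleEquiv.symm,
    Module.Projective.of_equiv ULift.moduleEquiv.symm,
    Module.Finite.equiv ULift.moduleEquiv.symm, Module.Finite.equiv ULift.moduleEquiv.symm,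
    ?_, ?_, hg.comp ULift.down_surjective⟩
  · intro a b hab
    exact ULift.ext _ _ (Subtype.ext (congrArg ULift.down hab))
  · intro y
    exact ⟨fun hy => ⟨⟨⟨y.down, hy⟩⟩, rfl⟩, by rintro ⟨k, rfl⟩; exact k.down.2⟩
end

section
/- Let k be a field, A a finite-dimensional k-algebra, and Y a finitely generated right A-module which is Ext-injective in cog(Y); set a' = ann_A(Y). Then there exists a short exact sequence 0 → Y¹ → Y⁰ → Hom_k(A/a', k) → 0 of right A/a'-modules, where Hom_k(A/a', k) carries the right A/a'-module structure induced by left multiplication, such that Y⁰ is a direct summand of Y^(d) for some d ≥ 0, Y¹ admits an injective homomorphism into Y^(n) for some n ≥ 0, and Ext¹_{A/a'}(M, Y¹) = 0 for every right A/a'-module M admitting an injective homomorphism into some Y^(m). -/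
open CategoryTheory

section Dual

variable (k : Type) [Field k] (A : Type) [Ring A] [Algebra k A]

instance annQuotModuleK (Y : Type) [AddCommGroup Y] [Module A Y] :
    Module k (AnnQuot A Y) :=
  { (inferInstance : DistribMulAction k (AnnQuot A Y)) with
    add_smul := fun r s x => Quotient.inductionOn' x fun a =>
      congr_arg RingCon.toQuotient (add_smul r s a)
    zero_smul := fun x => Quotient.inductionOn' x fun a =>
      congr_arg RingCon.toQuotient (zero_smul k a) }

/-- The right multiplication action of `A/a'` on its `k`-dual `D(A/a') = Hom_k(A/a', k)`. -/
instance dualSMul (Y : Type) [AddCommGroup Y] [Module A Y] :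
    SMul (AnnQuot A Y) (Module.Dual k (AnnQuot A Y)) :=
  ⟨fun c φ => φ ∘ₗ LinearMap.mulRight k c⟩

instance dualModule (Y : Type) [AddCommGroup Y] [Module A Y] :
    Module (AnnQuot A Y) (Module.Dual k (AnnQuot A Y)) where
  one_smul φ := LinearMap.ext fun x => by
    show φ (x * 1) = φ x
    rw [mul_one]
  mul_smul c d φ := LinearMap.ext fun x => by
    show φ (x * (c * d)) = φ (x * c * d)
    rw [mul_assoc]
  smul_zero c := LinearMap.ext fun x => rfl
  smul_add c φ ψ := LinearMap.ext fun x => rfl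
  add_smul c d φ := LinearMap.ext fun x => by
    show φ (x * (c + d)) = φ (x * c) + φ (x * d)
    rw [mul_add, map_add]
  zero_smul φ := LinearMap.ext fun x => by
    show φ (x * 0) = 0
    rw [mul_zero, map_zero]

end Dual

theorem LinearMap.exists_comp_eq_of_ker_le {R X Z N : Type*} [Ring R] [AddCommGroup X] [Module R X]
    [AddCommGroup Z] [Module R Z] [AddCommGroup N] [Module R N] (f : X →ₗ[R] Z)
    (hf : Function.Surjective f) (φ : X →ₗ[R] N) (h : ∀ x, f x = 0 → φ x = 0) :
    ∃ ψ : Z →ₗ[R] N, ∀ x, ψ (f x) = φ x := by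
  refine ⟨(LinearMap.ker f).liftQ φ h ∘ₗ (f.quotKerEquivOfSurjective hf).symm.toLinearMap,
    fun x => ?_⟩
  have : (f.quotKerEquivOfSurjective hf).symm (f x) = (LinearMap.ker f).mkQ x := by
    rw [LinearEquiv.symm_apply_eq]
    rfl
  exact (congrArg ((LinearMap.ker f).liftQ φ h) this).trans (Submodule.liftQ_apply _ φ x)

/-- `Ext¹(M, N)` vanishes iff every degree-one cocycle of `Hom(P, N)` is a coboundary,
where `P` is a projective resolution of `M`. -/
theorem subsingleton_ext1_iff_cocycle {R : Type} [Ring R] (M N : Type) [AddCommGroup M]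
    [Module R M] [AddCommGroup N] [Module R N]
    (P : ProjectiveResolution (ModuleCat.of R M)) :
    Subsingleton (ext1 R M N) ↔
      ∀ φ : P.complex.X 1 ⟶ ModuleCat.of R N, P.complex.d 2 1 ≫ φ = 0 →
        ∃ ψ : P.complex.X 0 ⟶ ModuleCat.of R N, P.complex.d 1 0 ≫ ψ = φ := by
  rw [← ModuleCat.isZero_iff_subsingleton, (P.isoExt 1 (ModuleCat.of R N)).isZero_iff,
    ← HomologicalComplex.exactAt_iff_isZero_homology,
    HomologicalComplex.exactAt_iff' _ 0 1 2 (by simp) (by simp),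
    ShortComplex.moduleCat_exact_iff]
  exact Iff.rfl

/-- Every homomorphism into `N` from the kernel of a surjection onto `M` extends. -/
def ExtendsFromKernels (R : Type) [Ring R] (M N : Type) [AddCommGroup M] [Module R M]
    [AddCommGroup N] [Module R N] : Prop :=
  ∀ (E : Type) [AddCommGroup E] [Module R E] (p : E →ₗ[R] M), Function.Surjective p →
    ∀ φ : LinearMap.ker p →ₗ[R] N, ∃ ψ : E →ₗ[R] N, ∀ x : LinearMap.ker p, ψ x = φ x

theorem subsingleton_ext1_iff_extendsFromKernels {R : Type} [Ring R] (M N : Type) [AddCommGroup M]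
    [Module R M] [AddCommGroup N] [Module R N] :
    Subsingleton (ext1 R M N) ↔ ExtendsFromKernels R M N := by
  let P := ProjectiveResolution.of (ModuleCat.of R M)
  let d : P.complex.X 1 →ₗ[R] P.complex.X 0 := (P.complex.d 1 0).hom
  let π : P.complex.X 0 →ₗ[R] M := (P.π.f 0).hom
  have hπ : Function.Surjective π :=
    (ModuleCat.epi_iff_surjective _).mp (inferInstance : Epi (P.π.f 0))
  have hexact : Function.Exact d π :=
    (ShortComplex.ShortExact.moduleCat_exact_iff_function_exact _).mp P.exact₀
  have hexact₁ : Function.Exact (P.complex.d 2 1).hom d :=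
    (ShortComplex.ShortExact.moduleCat_exact_iff_function_exact _).mp (P.exact_succ 0)
  rw [subsingleton_ext1_iff_cocycle M N P]
  constructor
  · intro h E _ _ p hp φ
    have : Module.Projective R (P.complex.X 0) := inferInstance
    obtain ⟨u, hu⟩ := Module.projective_lifting_property p π hp
    have hu' : ∀ x, p (u x) = π x := fun x => LinearMap.congr_fun hu x
    let v : P.complex.X 1 →ₗ[R] LinearMap.ker p :=
      (u ∘ₗ d).codRestrict _ fun x => by
        simpa [hu'] using hexact.apply_apply_eq_zero x
    have hv : ∀ x, ((v x : LinearMap.ker p) : E) = u (d x) := fun x => rfl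
    obtain ⟨ψ, hψ⟩ := h (ModuleCat.ofHom (φ ∘ₗ v)) (by
      ext x
      have : v ((P.complex.d 2 1).hom x) = 0 := Subtype.ext (by
        rw [hv, hexact₁.apply_apply_eq_zero, map_zero]; rfl)
      simpa using congrArg φ this)
    have hψ' : ∀ x, ψ.hom (d x) = φ (v x) := fun x =>
      LinearMap.congr_fun (congrArg ModuleCat.Hom.hom hψ) x
    obtain ⟨χ, hχ⟩ := LinearMap.exists_comp_eq_of_ker_le
      ((LinearMap.ker p).subtype.coprod u) (fun e => by
        obtain ⟨x, hx⟩ := hπ (p e)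
        exact ⟨(⟨e - u x, by simp [hu', hx]⟩, x), by simp⟩)
      (φ.coprod ψ.hom) (by
        rintro ⟨y, x⟩ hyx
        replace hyx : (y : E) + u x = 0 := by simpa using hyx
        obtain ⟨z, rfl⟩ := (hexact x).mp (by
          have := congrArg p hyx
          simpa [hu'] using this)
        have : y + v z = 0 := Subtype.ext (by simpa [hv] using hyx)
        have := congrArg φ this
        simpa [hψ'] using this)
    exact ⟨χ, fun x => by simpa using hχ (x, 0)⟩
  · intro h φ hφ
    let v : P.complex.X 1 →ₗ[R] LinearMap.ker π :=
      d.codRestrict _ fun x => hexact.apply_apply_eq_zero x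
    obtain ⟨φ', hφ'⟩ := LinearMap.exists_comp_eq_of_ker_le v
      (fun y => by
        obtain ⟨z, hz⟩ := (hexact y).mp y.2
        exact ⟨z, Subtype.ext hz⟩) φ.hom (by
        intro x hx
        obtain ⟨z, rfl⟩ := (hexact₁ x).mp (congrArg Subtype.val hx)
        exact LinearMap.congr_fun (congrArg ModuleCat.Hom.hom hφ) z)
    obtain ⟨ψ, hψ⟩ := h _ π hπ φ'
    refine ⟨ModuleCat.ofHom ψ, ?_⟩
    ext x
    exact (hψ (v x)).trans (hφ' x)

/-- Vanishing of `Ext¹(-, N)` passes to finite powers of `N`. -/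
theorem ExtendsFromKernels.pi {R : Type} [Ring R] {M N : Type} [AddCommGroup M] [Module R M]
    [AddCommGroup N] [Module R N] (h : ExtendsFromKernels R M N) (ι : Type) :
    ExtendsFromKernels R M (ι → N) := by
  intro E _ _ p hp φ
  choose ψ hψ using fun i => h E p hp (LinearMap.proj i ∘ₗ φ)
  exact ⟨LinearMap.pi ψ, fun x => funext fun i => hψ i x⟩

/-- If every map `M → D` lifts along `g : N → D`, then vanishing of `Ext¹(M, N)` passes to the
kernel of `g`. -/
theorem ExtendsFromKernels.ker {R : Type} [Ring R] {M N D : Type} [AddCommGroup M] [Module R M]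
    [AddCommGroup N] [Module R N] [AddCommGroup D] [Module R D] (h : ExtendsFromKernels R M N)
    (g : N →ₗ[R] D) (hg : ∀ θ : M →ₗ[R] D, ∃ χ : M →ₗ[R] N, g ∘ₗ χ = θ) :
    ExtendsFromKernels R M (LinearMap.ker g) := by
  intro E _ _ p hp φ
  obtain ⟨ψ, hψ⟩ := h E p hp ((LinearMap.ker g).subtype ∘ₗ φ)
  obtain ⟨θ, hθ⟩ := LinearMap.exists_comp_eq_of_ker_le p hp (g ∘ₗ ψ) (fun x hx => by
    simp [show ψ x = _ from hψ ⟨x, hx⟩])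
  obtain ⟨χ, hχ⟩ := hg θ
  have hχ' : ∀ x, g (χ x) = θ x := fun x => LinearMap.congr_fun hχ x
  refine ⟨(ψ - χ ∘ₗ p).codRestrict _ fun x => by simp [hχ', hθ], fun x => Subtype.ext ?_⟩
  simp [hψ]

/-- Vanishing of `Ext¹(M, Y)` over `A` implies vanishing over `A/ann(Y)`. -/
theorem extendsFromKernels_annQuot {A Y : Type} [Ring A] [AddCommGroup Y] [Module A Y]
    (hY : ∀ (M : Type) [AddCommGroup M] [Module A M], IsCogBy A Y M →
      Subsingleton (ext1 A M Y))
    (M : Type) [AddCommGroup M] [Module (AnnQuot A Y) M] (hM : IsCogBy (AnnQuot A Y) Y M) :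
    ExtendsFromKernels (AnnQuot A Y) M Y := by
  intro E _ _ p hp φ
  let q : A →+* AnnQuot A Y := (annRingCon A Y).mk'
  have hq : Function.Surjective q := RingCon.mk'_surjective _
  let _ : Module A M := Module.compHom M q
  let _ : Module A E := Module.compHom E q
  have hcog : IsCogBy A Y M := by
    obtain ⟨n, f, hf⟩ := hM
    exact ⟨n, { toFun := f, map_add' := map_add f,
                map_smul' := fun a m => map_smul f (q a) m }, hf⟩
  obtain ⟨ψ, hψ⟩ := (subsingleton_ext1_iff_extendsFromKernels M Y).mp (hY M hcog) E
    { toFun := p, map_add' := map_add p, map_smul' := fun a e => map_smul p (q a) e } hp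
    { toFun := fun x => φ ⟨x, x.2⟩
      map_add' := fun x y => map_add φ ⟨x, x.2⟩ ⟨y, y.2⟩
      map_smul' := fun a x => map_smul φ (q a) ⟨x, x.2⟩ }
  refine ⟨{ toFun := ψ, map_add' := map_add ψ, map_smul' := fun b e => ?_ },
    fun x => hψ ⟨x, x.2⟩⟩
  obtain ⟨a, rfl⟩ := hq b
  exact map_smul ψ a e

section DualApproximation

variable (k : Type) [Field k] (A : Type) [Ring A] [Algebra k A]
  (Y : Type) [AddCommGroup Y] [Module A Y] [Module k Y]

theorem isScalarTower_annQuot [IsScalarTower k A Y] : IsScalarTower k (AnnQuot A Y) Y :=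
  ⟨fun c b y => Quotient.inductionOn' b fun a => smul_assoc c a y⟩

/-- `A/ann(Y)` embeds into a finite power of `Y`. -/
theorem isCogBy_annQuot_self [IsScalarTower k (AnnQuot A Y) Y] [Module.Finite k Y] :
    IsCogBy (AnnQuot A Y) Y (AnnQuot A Y) := by
  have : SMulCommClass (AnnQuot A Y) k Y := IsScalarTower.to_smulCommClass'
  let e := Module.finBasis k Y
  refine ⟨_, LinearMap.pi fun i => LinearMap.toSpanSingleton _ _ (e i), ?_⟩
  rw [injective_iff_map_eq_zero]
  intro b hb
  have hb' : DistribSMul.toLinearMap k Y b = 0 := e.ext fun i => congrFun hb i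
  obtain ⟨a, rfl⟩ := RingCon.mk'_surjective _ b
  refine (RingCon.eq _).mpr fun y => ?_
  rw [zero_smul]
  exact LinearMap.congr_fun hb' y

variable {Y}

/-- The homomorphism `Yᵈ → D(A/ann(Y))` induced by `d` functionals on `Y`. -/
def dualApprox [IsScalarTower k (AnnQuot A Y) Y] {d : ℕ} (φ : Fin d → Module.Dual k Y) :
    (Fin d → Y) →ₗ[AnnQuot A Y] Module.Dual k (AnnQuot A Y) where
  toFun y :=
    { toFun := fun b => ∑ i, φ i (b • y i)
      map_add' := fun b c => by simp [add_smul, Finset.sum_add_distrib]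
      map_smul' := fun c b => by simp [smul_assoc, Finset.mul_sum] }
  map_add' y z := LinearMap.ext fun b => by simp [Finset.sum_add_distrib]
  map_smul' c y := LinearMap.ext fun b => by
    change ∑ i, φ i (b • c • y i) = ∑ i, φ i ((b * c) • y i)
    simp only [mul_smul]

theorem dualApprox_apply [IsScalarTower k (AnnQuot A Y) Y] {d : ℕ} (φ : Fin d → Module.Dual k Y)
    (y : Fin d → Y) (b : AnnQuot A Y) : dualApprox k A φ y b = ∑ i, φ i (b • y i) :=
  rfl

/-- If the functionals `φ` form a basis of the dual of `Y`, every homomorphism `M → D(A/ann(Y))`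
with `M` in `cog(Y)` lifts along `dualApprox k A φ`. -/
theorem exists_dualApprox_comp_eq [IsScalarTower k (AnnQuot A Y) Y] {d : ℕ}
    (φ : Module.Basis (Fin d) k (Module.Dual k Y))
    {M : Type} [AddCommGroup M] [Module (AnnQuot A Y) M] (hM : IsCogBy (AnnQuot A Y) Y M)
    (θ : M →ₗ[AnnQuot A Y] Module.Dual k (AnnQuot A Y)) :
    ∃ χ : M →ₗ[AnnQuot A Y] (Fin d → Y), dualApprox k A φ ∘ₗ χ = θ := by
  have : SMulCommClass (AnnQuot A Y) k Y := IsScalarTower.to_smulCommClass'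
  obtain ⟨m, f, hf⟩ := hM
  let _ : Module k M := Module.compHom M (algebraMap k (AnnQuot A Y))
  have : IsScalarTower k (AnnQuot A Y) M := ⟨fun c b x => by
    rw [Algebra.smul_def, mul_smul]; rfl⟩
  have hθ : ∀ x b, θ x b = θ (b • x) 1 := fun x b => by
    rw [map_smul]
    change θ x b = θ x (1 * b)
    rw [one_mul]
  let ev : M →ₗ[k] k :=
    { toFun := fun x => θ x 1
      map_add' := fun x y => by simp
      map_smul' := fun c x => by
        rw [← one_smul (AnnQuot A Y) x, ← smul_assoc, ← hθ, map_smul, one_smul]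
        rfl }
  obtain ⟨r, hr⟩ := (f.restrictScalars k).exists_leftInverse_of_injective
    (LinearMap.ker_eq_bot.mpr hf)
  let Θ : Fin m → Module.Dual k Y := fun j => ev ∘ₗ r ∘ₗ LinearMap.single k (fun _ => Y) j
  have hΘ : ∀ x, ∑ j, Θ j (f x j) = θ x 1 := fun x => by
    have h₁ : r (f x) = x := LinearMap.congr_fun hr x
    calc ∑ j, Θ j (f x j) = ev (r (∑ j, Pi.single j (f x j))) := by simp [Θ]
      _ = θ x 1 := by rw [Finset.univ_sum_single, h₁]; rfl
  refine ⟨LinearMap.pi fun i => ∑ j, φ.repr (Θ j) i • (LinearMap.proj j ∘ₗ f),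
    LinearMap.ext fun x => LinearMap.ext fun b => ?_⟩
  rw [hθ, ← hΘ, LinearMap.comp_apply, dualApprox_apply]
  have h₂ : ∀ j y, Θ j y = ∑ i, φ.repr (Θ j) i * φ i y := fun j y => by
    conv_lhs => rw [← φ.sum_repr (Θ j)]
    simp [-Module.Basis.sum_repr, LinearMap.sum_apply]
  simp only [h₂]
  rw [Finset.sum_comm]
  refine Finset.sum_congr rfl fun i _ => ?_
  simp [Finset.smul_sum, smul_comm b]

end DualApproximation

/-- If `Y` is a finitely generated module over a finite-dimensional `k`-algebra
`A` which is Ext-injective in `cog(Y)`, then over `A' = A/ann_A(Y)` there is a short exact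
sequence `0 → Y¹ → Y⁰ → D(A') → 0` with `Y⁰ ∈ add Y` and `Y¹ ∈ cog Y` Ext-injective
in `cog Y`. -/
theorem stmt5
    (k : Type) [Field k] (A : Type) [Ring A] [Algebra k A] [FiniteDimensional k A]
    (Y : Type) [AddCommGroup Y] [Module A Y] [Module.Finite A Y]
    (hY : ∀ (M : Type) [AddCommGroup M] [Module A M], IsCogBy A Y M →
      Subsingleton (ext1 A M Y)) :
    ∃ (Y1 Y0 : ModuleCat (AnnQuot A Y)) (f : Y1 →ₗ[AnnQuot A Y] Y0)
      (g : Y0 →ₗ[AnnQuot A Y] Module.Dual k (AnnQuot A Y)),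
      Function.Injective f ∧ Function.Exact f g ∧ Function.Surjective g ∧
      IsDirectSummandOf (AnnQuot A Y) Y Y0 ∧ IsCogBy (AnnQuot A Y) Y Y1 ∧
      ∀ (M : Type) [AddCommGroup M] [Module (AnnQuot A Y) M],
        IsCogBy (AnnQuot A Y) Y M → Subsingleton (ext1 (AnnQuot A Y) M Y1) := by
  let _ : Module k Y := Module.compHom Y (algebraMap k A)
  have : IsScalarTower k A Y := ⟨fun c a y => by
    rw [Algebra.smul_def, mul_smul]; rfl⟩
  have : IsScalarTower k (AnnQuot A Y) Y := isScalarTower_annQuot k A Y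
  have : Module.Finite k Y := Module.Finite.trans A Y
  let φ := Module.finBasis k (Module.Dual k Y)
  let g := dualApprox k A φ
  have hlift : ∀ (M : Type) [AddCommGroup M] [Module (AnnQuot A Y) M],
      IsCogBy (AnnQuot A Y) Y M → ∀ θ : M →ₗ[AnnQuot A Y] Module.Dual k (AnnQuot A Y),
        ∃ χ, g ∘ₗ χ = θ := fun M _ _ hM θ => exists_dualApprox_comp_eq k A φ hM θ
  refine ⟨ModuleCat.of _ (LinearMap.ker g), ModuleCat.of _ (Fin _ → Y),
    (LinearMap.ker g).subtype, g, Subtype.val_injective, fun y => by simp, ?_,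
    ⟨_, LinearMap.id, LinearMap.id, rfl⟩, ⟨_, (LinearMap.ker g).subtype, Subtype.val_injective⟩,
    fun M _ _ hM => (subsingleton_ext1_iff_extendsFromKernels _ _).mpr
      (((extendsFromKernels_annQuot hY M hM).pi _).ker g (hlift M hM))⟩
  intro ξ
  obtain ⟨χ, hχ⟩ := hlift _ (isCogBy_annQuot_self k A Y) (LinearMap.toSpanSingleton _ _ ξ)
  exact ⟨χ 1, by simpa using LinearMap.congr_fun hχ 1⟩
end
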